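/- Let q₀, q₁, q : X → [0,∞) be measurable with q₀(x) + q₁(x) ≤ q(x) for λ-a.e. x, and let χ : Ω → H be measurable and symmetric. Then ∫_{Ω × Ω} ‖χ(υ ⊔ κ)‖² q₀^⊗(υ) q₁^⊗(κ) d(μ ⊗ μ)(υ, κ) ≤ ∫_Ω ‖χ(ϑ)‖² q^⊗(ϑ) dμ(ϑ). (The multiple point splitter Δ is a contraction from the weighted Fock space with weight q into the tensor product of those with weights q₀, q₁, for every q ≥ q₀ + q₁.) -/

import Mathlib

open MeasureTheory ENNReal
open scoped NNReal

noncomputable section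

/-- The Guichardet space over `X`. -/
abbrev GS (X : Type*) := Σ n : ℕ, Fin n → X

/-- The Guichardet measure `μ = ∑ₙ (1/n!)·(Sigma.mk n)_* λ^{⊗n}`. -/
def guichardetMeasure {X : Type*} [MeasurableSpace X] (lam : Measure X) : Measure (GS X) :=
  Measure.sum fun n =>
    ((n.factorial : ℝ≥0∞))⁻¹ • Measure.map (Sigma.mk n) (Measure.pi fun _ : Fin n => lam)

/-- The product weight `q^⊗(n,x) = ∏ᵢ q(xᵢ)`. -/
def prodWeight {X : Type*} (q : X → ℝ≥0) (ϑ : GS X) : ℝ≥0∞ :=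
  ∏ i : Fin ϑ.1, (q (ϑ.2 i) : ℝ≥0∞)

/-- A function on the Guichardet space is symmetric if it is invariant under permutations
of the coordinates. -/
def SymmFun {X E : Type*} (χ : GS X → E) : Prop :=
  ∀ (n : ℕ) (σ : Equiv.Perm (Fin n)) (x : Fin n → X), χ ⟨n, x ∘ σ⟩ = χ ⟨n, x⟩

/-- Concatenation `υ ⊔ κ` of two elements of the Guichardet space. -/
def GS.concat {X : Type*} : GS X → GS X → GS X
  | ⟨m, y⟩, ⟨k, z⟩ => ⟨m + k, Fin.append y z⟩

section Splitting

variable {X : Type*} [MeasurableSpace X]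

lemma measurableEmbedding_sigmaMk {ι : Type*} {β : ι → Type*} [∀ i, MeasurableSpace (β i)]
    (i : ι) : MeasurableEmbedding (Sigma.mk i : β i → Sigma β) where
  injective := sigma_mk_injective
  measurable := fun s hs => MeasurableSpace.measurableSet_iInf.1 hs i
  measurableSet_image' := by
    intro s hs
    refine MeasurableSpace.measurableSet_iInf.2 fun j => ?_
    change MeasurableSet (Sigma.mk j ⁻¹' (Sigma.mk i '' s))
    by_cases h : j = i
    · subst h
      rwa [Set.preimage_image_eq _ sigma_mk_injective]
    · rw [Set.preimage_image_sigmaMk_of_ne h]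
      exact MeasurableSet.empty

lemma lintegral_guichardetMeasure (lam : Measure X) (F : GS X → ℝ≥0∞) :
    ∫⁻ ϑ, F ϑ ∂guichardetMeasure lam
      = ∑' n : ℕ, (n.factorial : ℝ≥0∞)⁻¹ * ∫⁻ x, F ⟨n, x⟩ ∂Measure.pi fun _ : Fin n => lam := by
  rw [guichardetMeasure, lintegral_sum_measure]
  refine tsum_congr fun n => ?_
  rw [lintegral_smul_measure, (measurableEmbedding_sigmaMk n).lintegral_map, smul_eq_mul]

lemma lintegral_guichardetMeasure_prod (lam : Measure X) [SigmaFinite lam]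
    (F : GS X × GS X → ℝ≥0∞) :
    ∫⁻ p, F p ∂(guichardetMeasure lam).prod (guichardetMeasure lam)
      = ∑' a : ℕ × ℕ, (a.1.factorial : ℝ≥0∞)⁻¹ * ((a.2.factorial : ℝ≥0∞)⁻¹ *
          ∫⁻ p, F (⟨a.1, p.1⟩, ⟨a.2, p.2⟩)
            ∂(Measure.pi fun _ : Fin a.1 => lam).prod (Measure.pi fun _ : Fin a.2 => lam)) := by
  rw [guichardetMeasure, Measure.prod_sum, lintegral_sum_measure]
  refine tsum_congr fun a => ?_
  rw [Measure.prod_smul_left, Measure.prod_smul_right, lintegral_smul_measure,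
    lintegral_smul_measure, Measure.map_prod_map _ _ (measurableEmbedding_sigmaMk _).measurable
      (measurableEmbedding_sigmaMk _).measurable,
    ((measurableEmbedding_sigmaMk a.1).prodMap (measurableEmbedding_sigmaMk a.2)).lintegral_map]
  rfl

/-- Integration over a product of powers of `lam` is integration over concatenated tuples. -/
lemma lintegral_append (lam : Measure X) [SigmaFinite lam] (m k : ℕ)
    (F : (Fin (m + k) → X) → ℝ≥0∞) :
    ∫⁻ p, F (Fin.append p.1 p.2)
        ∂(Measure.pi fun _ : Fin m => lam).prod (Measure.pi fun _ : Fin k => lam)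
      = ∫⁻ x, F x ∂Measure.pi fun _ : Fin (m + k) => lam := by
  rw [(measurePreserving_piCongrLeft (fun _ : Fin (m + k) => lam)
      finSumFinEquiv).lintegral_map_equiv,
    (measurePreserving_sumPiEquivProdPi_symm
      (fun _ : Fin m ⊕ Fin k => lam)).lintegral_map_equiv]
  refine lintegral_congr fun p => congrArg F ?_
  funext i
  obtain ⟨j, rfl⟩ := finSumFinEquiv.surjective i
  rw [MeasurableEquiv.piCongrLeft_apply_apply]
  cases j <;> simp [MeasurableEquiv.sumPiEquivProdPi, Equiv.sumPiEquivProdPi]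

lemma lintegral_comp_perm (lam : Measure X) [SigmaFinite lam] {n : ℕ} (σ : Equiv.Perm (Fin n))
    (F : (Fin n → X) → ℝ≥0∞) :
    ∫⁻ x, F (x ∘ σ) ∂(Measure.pi fun _ : Fin n => lam)
      = ∫⁻ x, F x ∂Measure.pi fun _ : Fin n => lam := by
  rw [(measurePreserving_piCongrLeft (fun _ : Fin n => lam) σ.symm).lintegral_map_equiv F]
  refine lintegral_congr fun x => congrArg F ?_
  funext i
  simpa using (MeasurableEquiv.piCongrLeft_apply_apply σ.symm (β := fun _ => X) x (σ i)).symm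

lemma exists_perm_mem_iff {α : Type*} [Fintype α] [DecidableEq α] {S T : Finset α}
    (h : S.card = T.card) : ∃ σ : Equiv.Perm α, ∀ i, σ i ∈ T ↔ i ∈ S := by
  have e : {x // x ∈ S} ≃ {x // x ∈ T} := Finset.equivOfCardEq h
  refine ⟨e.extendSubtype, fun i => ⟨fun hi => ?_, fun hi => e.extendSubtype_mem i hi⟩⟩
  by_contra hc
  exact e.extendSubtype_not_mem i hc hi

/-- The integral of `f` against the product weight with factor `q₀` at the coordinates in `S`
and `q₁` at the others. -/
def splitIntegral (lam : Measure X) (q₀ q₁ : X → ℝ≥0) {n : ℕ} (f : (Fin n → X) → ℝ≥0∞)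
    (S : Finset (Fin n)) : ℝ≥0∞ :=
  ∫⁻ x, f x * ∏ i, ((if i ∈ S then q₀ (x i) else q₁ (x i) : ℝ≥0) : ℝ≥0∞)
    ∂Measure.pi fun _ : Fin n => lam

lemma splitIntegral_congr_card (lam : Measure X) [SigmaFinite lam] (q₀ q₁ : X → ℝ≥0) {n : ℕ}
    {f : (Fin n → X) → ℝ≥0∞} (hf : ∀ (σ : Equiv.Perm (Fin n)) x, f (x ∘ σ) = f x)
    {S T : Finset (Fin n)} (h : S.card = T.card) :
    splitIntegral lam q₀ q₁ f S = splitIntegral lam q₀ q₁ f T := by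
  obtain ⟨σ, hσ⟩ := exists_perm_mem_iff h
  unfold splitIntegral
  rw [← lintegral_comp_perm lam σ]
  refine lintegral_congr fun x => ?_
  rw [hf, ← Equiv.prod_comp σ fun i => ((if i ∈ T then q₀ (x i) else q₁ (x i) : ℝ≥0) : ℝ≥0∞)]
  simp only [hσ, Function.comp_apply]

lemma lintegral_mul_prod_add (lam : Measure X) [SigmaFinite lam] {q₀ q₁ : X → ℝ≥0}
    (hq₀ : Measurable q₀) (hq₁ : Measurable q₁) {n : ℕ} {f : (Fin n → X) → ℝ≥0∞}
    (hf : Measurable f) :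
    ∫⁻ x, f x * ∏ i, ((q₀ (x i) + q₁ (x i) : ℝ≥0) : ℝ≥0∞) ∂(Measure.pi fun _ : Fin n => lam)
      = ∑ S : Finset (Fin n), splitIntegral lam q₀ q₁ f S := by
  unfold splitIntegral
  rw [← lintegral_finsetSum]
  · refine lintegral_congr fun x => ?_
    rw [← Finset.mul_sum]
    congr 1
    simp only [ENNReal.coe_add]
    rw [Finset.prod_add, Finset.powerset_univ]
    refine Finset.sum_congr rfl fun S _ => ?_
    rw [← Finset.prod_mul_prod_compl S, Finset.compl_eq_univ_sdiff]
    congr 1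
    · exact Finset.prod_congr rfl fun i hi => by rw [if_pos hi]
    · exact Finset.prod_congr rfl fun i hi => by rw [if_neg (Finset.mem_sdiff.1 hi).2]
  · intro S _
    refine hf.mul (Finset.measurable_prod _ fun i _ => Measurable.coe_nnreal_ennreal ?_)
    split_ifs
    · exact hq₀.comp (measurable_pi_apply i)
    · exact hq₁.comp (measurable_pi_apply i)

lemma sum_splitIntegral (lam : Measure X) [SigmaFinite lam] (q₀ q₁ : X → ℝ≥0) {n : ℕ}
    {f : (Fin n → X) → ℝ≥0∞} (hf : ∀ (σ : Equiv.Perm (Fin n)) x, f (x ∘ σ) = f x) :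
    (n.factorial : ℝ≥0∞)⁻¹ * ∑ S : Finset (Fin n), splitIntegral lam q₀ q₁ f S
      = ∑ a ∈ Finset.HasAntidiagonal.antidiagonal n, (a.1.factorial : ℝ≥0∞)⁻¹ * ((a.2.factorial : ℝ≥0∞)⁻¹ *
          splitIntegral lam q₀ q₁ f {i | i.val < a.1}) := by
  have hcard : ∀ S : Finset (Fin n), splitIntegral lam q₀ q₁ f S
      = splitIntegral lam q₀ q₁ f {i | i.val < S.card} := fun S =>
    splitIntegral_congr_card lam q₀ q₁ hf <| by
      have := Finset.card_le_univ S
      rw [Fintype.card_fin] at this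
      rw [Fin.card_filter_val_lt, min_eq_right this]
  rw [Finset.sum_congr rfl fun S _ => hcard S, ← Finset.powerset_univ,
    Finset.sum_powerset_apply_card fun j => splitIntegral lam q₀ q₁ f {i | i.val < j},
    Finset.card_univ, Fintype.card_fin,
    ← Finset.Nat.sum_antidiagonal_eq_sum_range_succ_mk fun a : ℕ × ℕ =>
      n.choose a.1 • splitIntegral lam q₀ q₁ f {i | i.val < a.1}, Finset.mul_sum]
  refine Finset.sum_congr rfl fun a ha => ?_
  rw [Finset.HasAntidiagonal.mem_antidiagonal] at ha
  rw [nsmul_eq_mul, ← mul_assoc, ← mul_assoc]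
  congr 1
  have hfac := Nat.add_choose_mul_factorial_mul_factorial a.1 a.2
  rw [← Nat.choose_symm_add, ha] at hfac
  have hne : ∀ j : ℕ, (j.factorial : ℝ≥0∞) ≠ 0 := fun j => by
    exact_mod_cast j.factorial_ne_zero
  have hc : (n.choose a.1 : ℝ≥0∞) ≠ 0 := by
    exact_mod_cast (Nat.choose_pos (by omega)).ne'
  rw [← hfac, Nat.cast_mul, Nat.cast_mul,
    ENNReal.mul_inv (.inr (natCast_ne_top _)) (.inr (hne _)),
    ENNReal.mul_inv (.inr (natCast_ne_top _)) (.inr (hne _)),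
    mul_right_comm, mul_right_comm _ _ (n.choose a.1 : ℝ≥0∞),
    ENNReal.inv_mul_cancel hc (natCast_ne_top _), one_mul]

lemma lintegral_concat_eq_splitIntegral (lam : Measure X) [SigmaFinite lam] (q₀ q₁ : X → ℝ≥0)
    (F : GS X → ℝ≥0∞) (m k : ℕ) :
    ∫⁻ p : (Fin m → X) × (Fin k → X), F (GS.concat ⟨m, p.1⟩ ⟨k, p.2⟩)
          * prodWeight q₀ ⟨m, p.1⟩ * prodWeight q₁ ⟨k, p.2⟩
        ∂(Measure.pi fun _ : Fin m => lam).prod (Measure.pi fun _ : Fin k => lam)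
      = splitIntegral lam q₀ q₁ (fun x : Fin (m + k) → X => F ⟨m + k, x⟩) {i | i.val < m} := by
  rw [splitIntegral, ← lintegral_append]
  refine lintegral_congr fun p => ?_
  rw [Fin.prod_univ_add, mul_assoc]
  simp [GS.concat, prodWeight]

end Splitting

/-- The multiple point splitter `Δ` is a contraction from the weighted Fock space with weight
`q` into the tensor product of those with weights `q₀`, `q₁`, whenever `q₀ + q₁ ≤ q` a.e. -/
theorem stmt5 {X : Type*} [MeasurableSpace X] (lam : Measure X) [SigmaFinite lam]
    {H : Type*} [NormedAddCommGroup H] [InnerProductSpace ℂ H] [MeasurableSpace H] [BorelSpace H]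
    (q₀ q₁ q : X → ℝ≥0) (hq₀ : Measurable q₀) (hq₁ : Measurable q₁) (hq : Measurable q)
    (hle : ∀ᵐ x ∂lam, q₀ x + q₁ x ≤ q x)
    (χ : GS X → H) (hχ : Measurable χ) (hχs : SymmFun χ) :
    ∫⁻ p : GS X × GS X,
        (‖χ (GS.concat p.1 p.2)‖₊ : ℝ≥0∞) ^ 2 * prodWeight q₀ p.1 * prodWeight q₁ p.2
      ∂((guichardetMeasure lam).prod (guichardetMeasure lam))
      ≤ ∫⁻ ϑ : GS X, (‖χ ϑ‖₊ : ℝ≥0∞) ^ 2 * prodWeight q ϑ ∂(guichardetMeasure lam) := by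
  rw [lintegral_guichardetMeasure_prod, lintegral_guichardetMeasure,
    ← Finset.HasAntidiagonal.sigmaAntidiagonalEquivProd.tsum_eq, ENNReal.tsum_sigma']
  refine ENNReal.tsum_le_tsum fun n => ?_
  set f : (Fin n → X) → ℝ≥0∞ := fun x => (‖χ ⟨n, x⟩‖₊ : ℝ≥0∞) ^ 2 with hf
  have hfm : Measurable f :=
    ((hχ.comp (measurableEmbedding_sigmaMk n).measurable).nnnorm.coe_nnreal_ennreal).pow_const 2
  have hfs : ∀ (σ : Equiv.Perm (Fin n)) x, f (x ∘ σ) = f x := fun σ x => by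
    simp only [hf, hχs n σ x]
  have hmono : ∫⁻ x, f x * ∏ i, ((q₀ (x i) + q₁ (x i) : ℝ≥0) : ℝ≥0∞)
        ∂(Measure.pi fun _ : Fin n => lam)
      ≤ ∫⁻ x, f x * prodWeight q ⟨n, x⟩ ∂(Measure.pi fun _ : Fin n => lam) := by
    have hae : ∀ᵐ x ∂(Measure.pi fun _ : Fin n => lam), ∀ i, q₀ (x i) + q₁ (x i) ≤ q (x i) :=
      ae_all_iff.2 fun i => (Measure.quasiMeasurePreserving_eval (fun _ : Fin n => lam) i).ae hle
    refine lintegral_mono_ae ?_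
    filter_upwards [hae] with x hx
    exact mul_le_mul_right (Finset.prod_le_prod' fun i _ => ENNReal.coe_le_coe.2 (hx i)) _
  calc _ = ∑ a ∈ Finset.HasAntidiagonal.antidiagonal n, (a.1.factorial : ℝ≥0∞)⁻¹ *
        ((a.2.factorial : ℝ≥0∞)⁻¹ * splitIntegral lam q₀ q₁ f {i | i.val < a.1}) := by
        rw [tsum_fintype, ← Finset.sum_coe_sort (Finset.HasAntidiagonal.antidiagonal n)]
        refine Finset.sum_congr rfl fun a _ => ?_
        obtain ⟨⟨m, k⟩, ha⟩ := a
        obtain rfl := Finset.HasAntidiagonal.mem_antidiagonal.1 ha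
        congr 2
        exact lintegral_concat_eq_splitIntegral lam q₀ q₁
          (fun ϑ => (‖χ ϑ‖₊ : ℝ≥0∞) ^ 2) m k
    _ = (n.factorial : ℝ≥0∞)⁻¹ * ∫⁻ x, f x * ∏ i, ((q₀ (x i) + q₁ (x i) : ℝ≥0) : ℝ≥0∞)
          ∂(Measure.pi fun _ : Fin n => lam) := by
        rw [lintegral_mul_prod_add lam hq₀ hq₁ hfm, sum_splitIntegral lam q₀ q₁ hfs]
    _ ≤ _ := by gcongr
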